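/- Suppose F : ℕ → ℕ∞ satisfies F n ≥ 1 for every n. If there is no m : ℕ such that {n | F n ≤ m} is infinite (equivalently, F tends to ⊤), then every maximal eventually different family in 𝒩_F is uncountable; otherwise, every eventually different family in 𝒩_F is finite. -/

import Mathlib

open scoped ENat

/-- The space `𝒩_F = {g : ℕ → ℕ | ∀ n, g n < F n}`. -/
def NF (F : ℕ → ℕ∞) : Set (ℕ → ℕ) := {g | ∀ n, (g n : ℕ∞) < F n}

/-- Two functions are eventually different. -/
def EvDiff (g₀ g₁ : ℕ → ℕ) : Prop := {n | g₀ n = g₁ n}.Finite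

/-- `E` is an eventually different family in `𝒩_F`. -/
def IsEDF (F : ℕ → ℕ∞) (E : Set (ℕ → ℕ)) : Prop :=
  E ⊆ NF F ∧ ∀ g₀ ∈ E, ∀ g₁ ∈ E, g₀ ≠ g₁ → EvDiff g₀ g₁

/-- `E` is a maximal eventually different family in `𝒩_F`. -/
def IsMEDF (F : ℕ → ℕ∞) (E : Set (ℕ → ℕ)) : Prop :=
  IsEDF F E ∧ ∀ E' : Set (ℕ → ℕ), IsEDF F E' → E ⊆ E' → E' = E

/-- If `F` tends to `⊤`, some member of `𝒩_F` is eventually different from each `f k`. -/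
theorem exists_mem_NF_forall_evDiff {F : ℕ → ℕ∞} (h1 : ∀ n, 1 ≤ F n)
    (hF : ∀ m : ℕ, {n : ℕ | F n ≤ (m : ℕ∞)}.Finite) (f : ℕ → ℕ → ℕ) :
    ∃ g ∈ NF F, ∀ k, EvDiff g (f k) := by
  have avoid : ∀ n, ∃ v : ℕ, (v : ℕ∞) < F n ∧
      ∀ k, v = f k n → n ≤ k ∨ F n ≤ ((k + 1 : ℕ) : ℕ∞) := by
    intro n
    obtain ⟨c, hc, hcn⟩ : ∃ c : ℕ, (c : ℕ∞) < F n ∧ (c = n ∨ F n = ((c + 1 : ℕ) : ℕ∞)) := by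
      cases hn : F n with
      | top => exact ⟨n, ENat.natCast_lt_top n, Or.inl rfl⟩
      | coe N =>
        have hN : 1 ≤ N := by exact_mod_cast hn ▸ h1 n
        refine ⟨N - 1, ?_, Or.inr ?_⟩
        · exact_mod_cast Nat.sub_lt hN one_pos
        · rw [Nat.sub_add_cancel hN]
    obtain ⟨v, hv, hvf⟩ : ∃ v ∈ Finset.range (c + 1),
        v ∉ (Finset.range c).image fun k => f k n := by
      apply Finset.exists_mem_notMem_of_card_lt_card
      calc _ ≤ (Finset.range c).card := Finset.card_image_le
        _ < _ := by simp
    refine ⟨v, lt_of_le_of_lt ?_ hc, fun k hk => ?_⟩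
    · exact_mod_cast Finset.mem_range_succ_iff.mp hv
    · have hck : c ≤ k := by
        by_contra! hlt
        exact hvf (Finset.mem_image.mpr ⟨k, Finset.mem_range.mpr hlt, hk.symm⟩)
      rcases hcn with rfl | hcn
      · exact Or.inl hck
      · right
        rw [hcn]
        exact_mod_cast Nat.succ_le_succ hck
  choose g hg hgf using avoid
  exact ⟨g, hg, fun k => ((Set.finite_Iic k).union (hF (k + 1))).subset fun n hn => hgf n k hn⟩

theorem EvDiff.symm {g₀ g₁ : ℕ → ℕ} (h : EvDiff g₀ g₁) : EvDiff g₁ g₀ := by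
  simpa only [EvDiff, eq_comm] using h

theorem not_evDiff_self (g : ℕ → ℕ) : ¬ EvDiff g g := by
  simpa [EvDiff] using Set.infinite_univ (α := ℕ)

theorem IsEDF.insert {F : ℕ → ℕ∞} {E : Set (ℕ → ℕ)} (hE : IsEDF F E) {g : ℕ → ℕ}
    (hg : g ∈ NF F) (h : ∀ e ∈ E, EvDiff g e) : IsEDF F (insert g E) := by
  refine ⟨Set.insert_subset hg hE.1, ?_⟩
  rintro a (rfl | ha) b (rfl | hb) hab
  · exact absurd rfl hab
  · exact h b hb
  · exact (h a ha).symm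
  · exact hE.2 a ha b hb hab

theorem IsMEDF.not_countable {F : ℕ → ℕ∞} (h1 : ∀ n, 1 ≤ F n)
    (hF : ∀ m : ℕ, {n : ℕ | F n ≤ (m : ℕ∞)}.Finite) {E : Set (ℕ → ℕ)} (hE : IsMEDF F E) :
    ¬ E.Countable := by
  intro hc
  obtain ⟨f, hf⟩ := Set.countable_iff_exists_subset_range.mp hc
  obtain ⟨g, hg, hgf⟩ := exists_mem_NF_forall_evDiff h1 hF f
  have hgE : ∀ e ∈ E, EvDiff g e := by
    intro e he
    obtain ⟨k, rfl⟩ := hf he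
    exact hgf k
  have hins := hE.2 _ (hE.1.insert hg hgE) (Set.subset_insert g E)
  exact not_evDiff_self g (hgE g (hins ▸ Set.mem_insert g E))

theorem IsEDF.finite {F : ℕ → ℕ∞} {m : ℕ} (hm : {n : ℕ | F n ≤ (m : ℕ∞)}.Infinite)
    {E : Set (ℕ → ℕ)} (hE : IsEDF F E) : E.Finite := by
  by_contra hinf
  obtain ⟨T, hTE, hT⟩ := Set.Infinite.exists_subset_card_eq hinf (m + 1)
  have hfin : (⋃ p ∈ T.offDiag, {n | p.1 n = p.2 n}).Finite := by
    refine T.offDiag.finite_toSet.biUnion fun p hp => ?_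
    obtain ⟨ha, hb, hab⟩ := Finset.mem_offDiag.mp hp
    exact hE.2 _ (hTE ha) _ (hTE hb) hab
  obtain ⟨n, hn, hnT⟩ := hm.exists_notMem_finite hfin
  have hcard : T.card ≤ (Finset.range m).card := by
    refine Finset.card_le_card_of_injOn (fun g => g n) (fun g hg => ?_) fun a ha b hb hab => ?_
    · have : (g n : ℕ∞) < m := (hE.1 (hTE hg) n).trans_le hn
      simpa using this
    · by_contra hne
      exact hnT (Set.mem_biUnion (x := (a, b)) (Finset.mem_offDiag.mpr ⟨ha, hb, hne⟩) hab)
  rw [hT, Finset.card_range] at hcard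
  omega

theorem stmt17 (F : ℕ → ℕ∞) (h1 : ∀ n, 1 ≤ F n) :
    ((¬ ∃ m : ℕ, {n : ℕ | F n ≤ (m : ℕ∞)}.Infinite) →
        ∀ E : Set (ℕ → ℕ), IsMEDF F E → ¬ E.Countable) ∧
    ((∃ m : ℕ, {n : ℕ | F n ≤ (m : ℕ∞)}.Infinite) →
        ∀ E : Set (ℕ → ℕ), IsEDF F E → E.Finite) := by
  refine ⟨fun h E hE => hE.not_countable h1 fun m => ?_, fun ⟨m, hm⟩ E hE => hE.finite hm⟩
  exact Set.not_infinite.mp fun hm => h ⟨m, hm⟩
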